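/- arXiv:2506.09074 — 2 statements merged into one kernel-verified Lean document; each statement's English description precedes it below -/
import Mathlib

section
/- Let (X,Δ) be a b-metric space with coefficient s ≥ 1. Every Matkowski φ-contraction T : X → X is a Leader contraction: for each ε > 0 there exist δ > 0 and r ∈ ℕ such that for all x,y ∈ X, Δ(x,y) < ε + δ implies Δ(T^r x, T^r y) < ε. -/
open Filter Topology NNReal

/-- In a b-metric space with coefficient s ≥ 1, every Matkowski φ-contraction is a Leader
contraction. -/
theorem matkowski_is_leader
    {X : Type*} (Δ : X → X → ℝ) (s : ℝ) (hs : 1 ≤ s)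
    (hnonneg : ∀ x y, 0 ≤ Δ x y)
    (hzero : ∀ x y, Δ x y = 0 ↔ x = y)
    (hsymm : ∀ x y, Δ x y = Δ y x)
    (htri : ∀ x y z, Δ x y ≤ s * (Δ x z + Δ z y))
    (T : X → X) (φ : ℝ≥0 → ℝ≥0)
    (hmono : Monotone φ)
    (hlt : ∀ t : ℝ≥0, 0 < t → φ t < t)
    (hiter : ∀ t : ℝ≥0, 0 < t → Tendsto (fun n => φ^[n] t) atTop (𝓝 0))
    (hcontr : ∀ x y, Δ (T x) (T y) ≤ (φ (Δ x y).toNNReal : ℝ)) :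
    ∀ ε > (0:ℝ), ∃ δ > (0:ℝ), ∃ r : ℕ,
      ∀ x y, Δ x y < ε + δ → Δ (T^[r] x) (T^[r] y) < ε := by
  intro ε hε
  have hpos : 0 < (ε + 1).toNNReal := Real.toNNReal_pos.2 (by linarith)
  obtain ⟨r, hr⟩ :=
    ((hiter _ hpos).eventually_lt_const (Real.toNNReal_pos.2 hε)).exists
  refine ⟨1, one_pos, r, fun x y hxy => ?_⟩
  have hbound : ∀ n : ℕ,
      (Δ (T^[n] x) (T^[n] y)).toNNReal ≤ φ^[n] (Δ x y).toNNReal := by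
    intro n
    induction n with
    | zero => exact le_rfl
    | succ n ih =>
      simp only [Function.iterate_succ_apply']
      exact (Real.toNNReal_le_iff_le_coe.2 (hcontr _ _)).trans (hmono ih)
  have hle : φ^[r] (Δ x y).toNNReal ≤ φ^[r] (ε + 1).toNNReal :=
    hmono.iterate r (Real.toNNReal_le_toNNReal hxy.le)
  exact (Real.toNNReal_lt_toNNReal_iff hε).1 (((hbound r).trans hle).trans_lt hr)
end

section
/- Let T : [0, 3/4] → [0, 3/4] be defined by T(x) = x/3 for x ∈ [0, 1/2] and T(x) = x/3 + 1/4 for x ∈ (1/2, 3/4], and equip [0, 3/4] with the usual distance |x − y|. Then for every n ≥ 1 and all x, y ∈ [0, 3/4], |T^n x − T^n y| ≤ |x − y|/3^n + 1/(4·3^{n−1}). -/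
open Set

/-- The map T(x) = x/3 on [0,1/2] and T(x) = x/3 + 1/4 on (1/2,3/4] (extended to ℝ by
the same formula, splitting at 1/2). -/
noncomputable def leaderMap : ℝ → ℝ :=
  fun x => if x ≤ 1/2 then x/3 else x/3 + 1/4

theorem leaderMap_mem_Icc {x : ℝ} (hx : x ∈ Icc (0:ℝ) (3/4)) :
    leaderMap x ∈ Icc (0:ℝ) (1/2) := by
  obtain ⟨h0, h1⟩ := hx
  unfold leaderMap
  split_ifs <;> constructor <;> linarith

theorem leaderMap_iterate_of_mem_Icc (n : ℕ) {x : ℝ} (hx : x ∈ Icc (0:ℝ) (1/2)) :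
    leaderMap^[n] x = x / 3 ^ n := by
  induction n generalizing x with
  | zero => simp
  | succ n ih =>
    obtain ⟨h0, h1⟩ := hx
    have hT : leaderMap x = x / 3 := if_pos h1
    rw [Function.iterate_succ_apply, hT, ih ⟨by linarith, by linarith⟩, div_div, pow_succ']

theorem abs_leaderMap_sub_le (x y : ℝ) :
    |leaderMap x - leaderMap y| ≤ |x - y| / 3 + 1 / 4 := by
  have h1 := le_abs_self (x - y)
  have h2 := neg_abs_le (x - y)
  unfold leaderMap
  rw [abs_le]
  split_ifs <;> constructor <;> linarith

/-- For every n ≥ 1 and all x, y ∈ [0, 3/4],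
|T^n x − T^n y| ≤ |x − y|/3^n + 1/(4·3^(n−1)). -/
theorem leaderMap_iterate_estimate :
    ∀ n : ℕ, 1 ≤ n → ∀ x ∈ Icc (0:ℝ) (3/4), ∀ y ∈ Icc (0:ℝ) (3/4),
      |leaderMap^[n] x - leaderMap^[n] y| ≤ |x - y| / 3 ^ n + 1 / (4 * 3 ^ (n - 1)) := by
  intro n hn x hx y hy
  obtain ⟨n, rfl⟩ := Nat.exists_eq_add_of_le' hn
  rw [Function.iterate_succ_apply, Function.iterate_succ_apply,
    leaderMap_iterate_of_mem_Icc n (leaderMap_mem_Icc hx),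
    leaderMap_iterate_of_mem_Icc n (leaderMap_mem_Icc hy), ← sub_div, abs_div,
    abs_of_pos (by positivity : (0:ℝ) < 3 ^ n), Nat.add_sub_cancel]
  calc |leaderMap x - leaderMap y| / 3 ^ n ≤ (|x - y| / 3 + 1 / 4) / 3 ^ n := by
        gcongr
        exact abs_leaderMap_sub_le x y
    _ = |x - y| / 3 ^ (n + 1) + 1 / (4 * 3 ^ n) := by
        rw [add_div, div_div, div_div, pow_succ']
end
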